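/- (Proposition 7) Let D ≥ 4 and let T^{ij} be a real-analytic symmetric tensor field on ℝ^D satisfying ∂_j T^{ij}=0 for all i and δ_{ij}T^{ij}=0. Then there exists a real-analytic tensor field C^{ikjp} on ℝ^D having Riemann symmetries and vanishing trace (Σ_i C^{ikip} = 0 for all k,p) such that T^{ij} = ∂_k∂_p C^{ikjp} (sum over k,p). -/

import Mathlib

/-- Partial derivative in the k-th Cartesian coordinate direction on ℝ^D. -/
noncomputable def pd {D : ℕ} (k : Fin D) (f : (Fin D → ℝ) → ℝ) : (Fin D → ℝ) → ℝ :=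
  fun x => fderiv ℝ f x (Pi.single k 1)

open Finset

section algebra
variable {n : ℕ} {A : Type*} [CommRing A]

/-- The Kronecker delta with values in `A`. -/
def kron (A : Type*) [CommRing A] {n : ℕ} (i j : Fin n) : A := if i = j then 1 else 0

theorem kron_comm (i j : Fin n) : kron A i j = kron A j i := by
  simp [kron, eq_comm]

@[simp] theorem sum_kron_mul (i : Fin n) (f : Fin n → A) : ∑ j, kron A i j * f j = f i := by
  simp [kron]

@[simp] theorem sum_kron_mul' (i : Fin n) (f : Fin n → A) : ∑ j, kron A j i * f j = f i := by
  simp [kron]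

@[simp] theorem sum_mul_kron (i : Fin n) (f : Fin n → A) : ∑ j, f j * kron A i j = f i := by
  simp [kron]

@[simp] theorem sum_mul_kron' (i : Fin n) (f : Fin n → A) : ∑ j, f j * kron A j i = f i := by
  simp [kron]

theorem sum_kron_self : ∑ i : Fin n, kron A i i = (n : A) := by
  simp [kron]

/-- The tensor `Bⁱᵏᵇ = xᵏ Mⁱᵇ - xⁱ Mᵏᵇ` with `M = 2 v ⊗ x - |x|² W`, `v = x ⬝ W`. -/
def specialTensor (x : Fin n → A) (W : Fin n → Fin n → A) (i k b : Fin n) : A :=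
  x k * (2 * (∑ m, x m * W i m) * x b - (∑ m, x m * x m) * W i b)
    - x i * (2 * (∑ m, x m * W k m) * x b - (∑ m, x m * x m) * W k b)

theorem specialTensor_antisymm (x : Fin n → A) (W : Fin n → Fin n → A) (i k b : Fin n) :
    specialTensor x W i k b = - specialTensor x W k i b := by
  simp only [specialTensor]; ring

theorem specialTensor_cyclic (x : Fin n → A) {W : Fin n → Fin n → A}
    (hsym : ∀ i j, W i j = W j i) (i k b : Fin n) :
    specialTensor x W i k b + specialTensor x W k b i + specialTensor x W b i k = 0 := by
  simp only [specialTensor]; rw [hsym b k, hsym b i, hsym k i]; ring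

variable [Algebra ℝ A]

@[simp] theorem derivation_kron (δ : Derivation ℝ A A) (i j : Fin n) : δ (kron A i j) = 0 := by
  unfold kron; split_ifs <;> simp

theorem derivation_two (δ : Derivation ℝ A A) : δ (2 : A) = 0 := by
  simpa using δ.map_natCast 2

/-- The Euler operator `∑ xₘ ∂ₘ`. -/
def euler (d : Fin n → Derivation ℝ A A) (x : Fin n → A) (f : A) : A := ∑ m, x m * d m f

theorem euler_mul (d : Fin n → Derivation ℝ A A) (x : Fin n → A) (f g : A) :
    euler d x (f * g) = f * euler d x g + g * euler d x f := by
  simp only [euler, Derivation.leibniz, smul_eq_mul, mul_sum, ← sum_add_distrib]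
  exact sum_congr rfl fun _ _ => by ring

theorem euler_sum {ι : Type*} (s : Finset ι) (d : Fin n → Derivation ℝ A A) (x : Fin n → A)
    (f : ι → A) : euler d x (∑ j ∈ s, f j) = ∑ j ∈ s, euler d x (f j) := by
  simp only [euler, map_sum, mul_sum]
  exact sum_comm

theorem euler_coord {d : Fin n → Derivation ℝ A A} {x : Fin n → A}
    (hx : ∀ j k, d j (x k) = kron A j k) (k : Fin n) : euler d x (x k) = x k := by
  simp [euler, hx]

/-- `∑ₖ ∂ₖ (xₖ f) = (E + n) f`. -/
theorem sum_deriv_coord_mul {d : Fin n → Derivation ℝ A A} {x : Fin n → A}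
    (hx : ∀ j k, d j (x k) = kron A j k) (f : A) :
    ∑ k, d k (x k * f) = euler d x f + n * f := by
  simp only [Derivation.leibniz, smul_eq_mul, hx, sum_add_distrib, ← mul_sum, sum_kron_self, euler]
  ring

/-- The Kulkarni–Nomizu product of `x ⊗ x` with `S`. -/
def radialProduct (x : Fin n → A) (S : Fin n → Fin n → A) (i k j p : Fin n) : A :=
  x i * x j * S k p + x k * x p * S i j - x i * x p * S k j - x k * x j * S i p

theorem sum_sum_deriv_radialProduct {d : Fin n → Derivation ℝ A A} {x : Fin n → A}
    (hx : ∀ j k, d j (x k) = kron A j k) {S U T : Fin n → Fin n → A}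
    (hsym : ∀ i j, S i j = S j i) (hdiv : ∀ i, ∑ j, d j (S i j) = 0)
    (hUdiv : ∀ j, ∑ i, d i (U i j) = 0)
    (hU : ∀ i j, euler d x (S i j) + n * S i j = U i j)
    (hT : ∀ i j, euler d x (U i j) + (n - 1) * U i j = T i j) (i j : Fin n) :
    ∑ k, ∑ p, d k (d p (radialProduct x S i k j p)) = T i j := by
  have hdiv' : ∀ i, ∑ j, d j (S j i) = 0 := fun i => by simpa only [hsym i] using hdiv i
  have h1 : ∀ k, ∑ p, d p (radialProduct x S i k j p)
      = x j * S k i + x i * S k j + x k * (U i j + S i j)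
        - (x i * (U k j + S k j)) - (x j * S i k + x k * S i j + x k * x j * 0) := by
    intro k
    simp only [radialProduct, map_add, map_sub, sum_add_distrib, sum_sub_distrib]
    have e1 : ∑ p, d p (x i * x j * S k p) = x j * S k i + x i * S k j := by
      simp only [Derivation.leibniz, smul_eq_mul, hx, sum_add_distrib, ← mul_sum, hdiv,
        mul_add, ← mul_assoc]
      simp
      ring
    have e2 : ∑ p, d p (x k * x p * S i j) = x k * (U i j + S i j) := by
      have := sum_deriv_coord_mul hx (x k * S i j)
      rw [euler_mul, euler_coord hx] at this
      rw [← hU, sum_congr rfl fun p _ => by rw [show x k * x p * S i j = x p * (x k * S i j) by ring],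
        this]
      ring
    have e3 : ∑ p, d p (x i * x p * S k j) = x i * (U k j + S k j) := by
      have := sum_deriv_coord_mul hx (x i * S k j)
      rw [euler_mul, euler_coord hx] at this
      rw [← hU, sum_congr rfl fun p _ => by rw [show x i * x p * S k j = x p * (x i * S k j) by ring],
        this]
      ring
    have e4 : ∑ p, d p (x k * x j * S i p) = x j * S i k + x k * S i j := by
      simp only [Derivation.leibniz, smul_eq_mul, hx, sum_add_distrib, ← mul_sum, hdiv,
        mul_add, ← mul_assoc]
      simp
      ring
    rw [e1, e2, e3, e4]; ring
  simp only [← map_sum, h1]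
  have h2 : ∀ k, x j * S k i + x i * S k j + x k * (U i j + S i j)
        - (x i * (U k j + S k j)) - (x j * S i k + x k * S i j + x k * x j * 0)
        = x k * U i j - x i * U k j := by
    intro k; rw [hsym k i]; ring
  simp only [h2, map_sub, sum_sub_distrib, sum_deriv_coord_mul hx]
  simp only [Derivation.leibniz, smul_eq_mul, sum_add_distrib, hx, ← mul_sum, hUdiv, sum_mul_kron']
  rw [← hT]; ring

/-- The divergence `∑ₘ ∂ₘ Bᵏᵐᵖ` of a tensor over its second index. -/
def midDiv (d : Fin n → Derivation ℝ A A) (B : Fin n → Fin n → Fin n → A) (k p : Fin n) : A :=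
  ∑ m, d m (B k m p)

/-- A tensor built from first derivatives of `B` and `β` which is identically divergence-free
in its second index. -/
def gaugeTensor (d : Fin n → Derivation ℝ A A) (B : Fin n → Fin n → Fin n → A)
    (β : Fin n → A) (i k j p : Fin n) : A :=
  d j (B i k p) - d p (B i k j)
    + kron A i j * midDiv d B k p - kron A i p * midDiv d B k j
    - kron A k j * midDiv d B i p + kron A k p * midDiv d B i j
    + (∑ m, d m (β m)) * (kron A i j * kron A k p - kron A i p * kron A k j)
    + d p (β i) * kron A k j - d j (β i) * kron A k p
    + d j (β k) * kron A i p - d p (β k) * kron A i j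

theorem sum_deriv_gaugeTensor {d : Fin n → Derivation ℝ A A}
    (hcomm : ∀ i j f, d i (d j f) = d j (d i f)) {B : Fin n → Fin n → Fin n → A}
    (hB : ∀ i k b, B i k b = - B k i b) (β : Fin n → A) (i j p : Fin n) :
    ∑ k, d k (gaugeTensor d B β i k j p) = 0 := by
  have hb : ∀ p, ∑ k, d k (midDiv d B k p) = 0 := by
    intro p
    have h : ∑ k, d k (midDiv d B k p) = - ∑ k, d k (midDiv d B k p) := by
      conv_lhs => simp only [midDiv, map_sum]
      rw [sum_comm]
      simp only [midDiv, map_sum, ← sum_neg_distrib]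
      refine sum_congr rfl fun k _ => sum_congr rfl fun m _ => ?_
      rw [hcomm, hB]; simp
    have h2 : (2 : ℝ) • ∑ k, d k (midDiv d B k p) = 0 := by
      rw [two_smul]; nth_rewrite 1 [h]; simp
    simpa using congrArg (fun a : A => (2 : ℝ)⁻¹ • a) h2
  have hd : ∀ q, ∑ k, d k (d q (B i k p)) = d q (midDiv d B i p) := by
    intro q; simp only [midDiv, map_sum]; exact sum_congr rfl fun k _ => hcomm _ _ _
  have hd' : ∀ q, ∑ k, d k (d q (B i k j)) = d q (midDiv d B i j) := by
    intro q; simp only [midDiv, map_sum]; exact sum_congr rfl fun k _ => hcomm _ _ _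
  have hβ : ∀ q, ∑ k, d k (d q (β k)) = d q (∑ m, d m (β m)) := by
    intro q; simp only [map_sum]; exact sum_congr rfl fun k _ => hcomm _ _ _
  generalize hσ : ∑ m, d m (β m) = σ at hβ
  simp only [gaugeTensor, hσ, map_add, map_sub, Derivation.leibniz, smul_eq_mul, derivation_kron,
    mul_zero, add_zero, zero_add, sum_add_distrib, sum_sub_distrib, hd, hd', mul_assoc,
    mul_sub, ← mul_sum, hb, hβ, sum_kron_mul']
  rw [hcomm j p]
  ring

theorem sum_gaugeTensor {d : Fin n → Derivation ℝ A A} {B : Fin n → Fin n → Fin n → A}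
    (hB : ∀ i k b, B i k b = - B k i b) {β : Fin n → A}
    (hβ : ∀ i, (n - 2) * β i = ∑ k, B i k k) (i j : Fin n) :
    ∑ k, gaugeTensor d B β i k j k = (n - 3) * midDiv d B i j := by
  have h1 : ∑ k, d j (B i k k) = (n - 2) * d j (β i) := by
    rw [← map_sum, ← hβ]; simp [Derivation.leibniz, derivation_two]
  have h2 : ∑ k, midDiv d B k k = - ((n - 2) * ∑ m, d m (β m)) := by
    simp only [midDiv]
    rw [sum_comm, mul_sum, ← sum_neg_distrib]
    refine sum_congr rfl fun m _ => ?_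
    have : ∑ k, B k m k = - ((n - 2) * β m) := by
      rw [hβ, ← sum_neg_distrib]; exact sum_congr rfl fun k _ => hB _ _ _
    rw [← map_sum, this]; simp [Derivation.leibniz, derivation_two]
  have h3 : ∑ k, d k (B i k j) = midDiv d B i j := rfl
  generalize hσ : ∑ m, d m (β m) = σ at h2
  simp only [gaugeTensor, hσ, sum_add_distrib, sum_sub_distrib, ← mul_sum, ← sum_mul, h1, h2, h3,
    sum_kron_self, sum_kron_mul, sum_kron_mul', mul_sub, sum_mul_kron, sum_mul_kron']
  ring

theorem midDiv_specialTensor {d : Fin n → Derivation ℝ A A} {x : Fin n → A}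
    (hx : ∀ j k, d j (x k) = kron A j k) {W Z : Fin n → Fin n → A}
    (hsym : ∀ i j, W i j = W j i) (hdiv : ∀ i, ∑ j, d j (W i j) = 0)
    (htr : ∑ i, W i i = 0)
    (hZ : ∀ i j, euler d x (W i j) + (n + 1) * W i j = Z i j) (i p : Fin n) :
    midDiv d (specialTensor x W) i p
      = 2 * (∑ m, x m * Z i m) * x p - (∑ m, x m * x m) * Z i p := by
  have hdiv' : ∀ i, ∑ j, d j (W j i) = 0 := fun i => by simpa only [hsym i] using hdiv i
  set q := ∑ m, x m * x m with hq
  set v : Fin n → A := fun i => ∑ m, x m * W i m with hv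
  have hdq : ∀ m, d m q = 2 * x m := by
    intro m
    simp only [hq, map_sum, Derivation.leibniz, smul_eq_mul, hx, sum_add_distrib, sum_mul_kron]
    ring
  have hEq : euler d x q = 2 * q := by
    rw [hq, euler_sum, mul_sum]
    refine sum_congr rfl fun m _ => ?_
    rw [euler_mul, euler_coord hx]; ring
  have hEW : ∀ i j, euler d x (W i j) = Z i j - (n + 1) * W i j := fun i j => by
    rw [← hZ]; ring
  have hEv : ∀ i, euler d x (v i) = (∑ m, x m * Z i m) - n * v i := by
    intro i
    simp only [hv, euler_sum, mul_sum, ← sum_sub_distrib]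
    refine sum_congr rfl fun m _ => ?_
    rw [euler_mul, euler_coord hx, hEW]; ring
  have hdv : ∑ m, d m (v m) = 0 := by
    simp only [hv, map_sum, Derivation.leibniz, smul_eq_mul, hx, sum_add_distrib, sum_mul_kron, htr]
    rw [sum_comm]
    simp only [← mul_sum, hdiv']; simp
  have hdM : ∑ m, d m (2 * v m * x p - q * W m p) = 0 := by
    have hxv : ∑ m, W m p * (2 * x m) = 2 * v p := by
      simp only [hv, mul_sum]; exact sum_congr rfl fun m _ => by rw [hsym]; ring
    simp only [map_sub, Derivation.leibniz, smul_eq_mul, hx, hdq, sum_sub_distrib, sum_add_distrib,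
      derivation_two, hxv, mul_zero, add_zero, ← mul_sum, hdiv', hdv, sum_mul_kron']
    ring
  have hE2 : euler d x (2 : A) = 0 := by
    simp [euler, derivation_two]
  have hEM : ∀ i, euler d x (2 * v i * x p - q * W i p)
      = 2 * (∑ m, x m * Z i m) * x p - q * Z i p - (n - 1) * (2 * v i * x p - q * W i p) := by
    intro i
    have hsub : ∀ f g, euler d x (f - g) = euler d x f - euler d x g := fun f g => by
      simp [euler, mul_sub]
    rw [hsub, euler_mul, euler_mul, euler_mul, hEv, hEW, hE2, hEq, euler_coord hx]; ring
  have hmain : ∑ m, d m (x i * (2 * v m * x p - q * W m p)) = 2 * v i * x p - q * W i p := by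
    simp only [(d _).leibniz (x i), smul_eq_mul, hx, sum_add_distrib, ← mul_sum, hdM]
    simp
  have h := sum_deriv_coord_mul hx (2 * v i * x p - q * W i p)
  simp only [midDiv, specialTensor, map_sub (d _) (_ * (_ - _)), sum_sub_distrib]
  rw [← hq, h, hmain, hEM]; ring

/-- A symmetric transverse traceless tensor obtained from `W` by two radial integrations is the
double divergence of a tensor with Weyl symmetries. -/
theorem exists_weyl_potential {d : Fin n → Derivation ℝ A A} {x : Fin n → A}
    (hcomm : ∀ i j f, d i (d j f) = d j (d i f))
    (hx : ∀ j k, d j (x k) = kron A j k) {W Z S U T : Fin n → Fin n → A} {β : Fin n → A}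
    (hWsym : ∀ i j, W i j = W j i) (hWdiv : ∀ i, ∑ j, d j (W i j) = 0)
    (hWtr : ∑ i, W i i = 0)
    (hβ : ∀ i, (n - 2) * β i = ∑ k, specialTensor x W i k k)
    (hZ : ∀ i j, euler d x (W i j) + (n + 1) * W i j = Z i j)
    (hZS : ∀ i j, 2 * (n - 3) * Z i j = S i j)
    (hSsym : ∀ i j, S i j = S j i) (hSdiv : ∀ i, ∑ j, d j (S i j) = 0)
    (hStr : ∑ i, S i i = 0)
    (hUdiv : ∀ j, ∑ i, d i (U i j) = 0)
    (hU : ∀ i j, euler d x (S i j) + n * S i j = U i j)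
    (hT : ∀ i j, euler d x (U i j) + (n - 1) * U i j = T i j) :
    ∃ C : Fin n → Fin n → Fin n → Fin n → A,
      (∀ i k j p, C i k j p = - C k i j p) ∧
      (∀ i k j p, C i k j p = - C i k p j) ∧
      (∀ i k j p, C i k j p = C j p i k) ∧
      (∀ i k j p, C i k j p + C i j p k + C i p k j = 0) ∧
      (∀ k p, ∑ i, C i k i p = 0) ∧
      (∀ i j, T i j = ∑ k, ∑ p, d k (d p (C i k j p))) := by
  have hB := specialTensor_antisymm x W
  have hBc := specialTensor_cyclic x hWsym
  have hb := midDiv_specialTensor hx hWsym hWdiv hWtr hZ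
  have hdiv := sum_deriv_gaugeTensor hcomm hB β
  have htr := sum_gaugeTensor (d := d) hB hβ
  have hanti1 : ∀ i k j p, gaugeTensor d (specialTensor x W) β i k j p
      = - gaugeTensor d (specialTensor x W) β k i j p := by
    intro i k j p
    simp only [gaugeTensor]
    rw [hB i k p, hB i k j, map_neg, map_neg]; ring
  have hanti2 : ∀ i k j p, gaugeTensor d (specialTensor x W) β i k j p
      = - gaugeTensor d (specialTensor x W) β i k p j := by
    intro i k j p
    simp only [gaugeTensor]; ring
  have hbianchi : ∀ i k j p,
      gaugeTensor d (specialTensor x W) β i k j p + gaugeTensor d (specialTensor x W) β j p i k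
      + (gaugeTensor d (specialTensor x W) β i j p k + gaugeTensor d (specialTensor x W) β p k i j)
      + (gaugeTensor d (specialTensor x W) β i p k j + gaugeTensor d (specialTensor x W) β k j i p)
      = 0 := by
    intro i k j p
    simp only [gaugeTensor]
    have e1 := congrArg (d i) (hBc j p k)
    have e2 := congrArg (d k) (hBc i j p)
    have e3 := congrArg (d j) (hBc i p k)
    have e4 := congrArg (d p) (hBc i k j)
    simp only [map_add, map_zero] at e1 e2 e3 e4
    have f2 := congrArg (d k) (hB i p j)
    have f3 := congrArg (d j) (hB i k p)
    have f4 := congrArg (d p) (hB i j k)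
    rw [map_neg] at f2 f3 f4
    rw [kron_comm j i, kron_comm p i, kron_comm k i, kron_comm p k, kron_comm j k, kron_comm p j]
    linear_combination e1 - e2 - e3 - e4 + f2 + f3 + f4
  have hR : ∀ i j, ∑ k, radialProduct x S i k j k
      = (∑ m, x m * x m) * S i j - x i * (∑ m, x m * S j m) - x j * (∑ m, x m * S i m) := by
    intro i j
    simp only [radialProduct, sum_add_distrib, sum_sub_distrib, ← mul_sum, hStr, sum_mul]
    simp only [mul_sum, mul_zero, zero_add, hSsym _ j]
    congr 1
    · congr 1
      exact sum_congr rfl fun m _ => by ring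
    · exact sum_congr rfl fun m _ => by ring
  have hsymm : ∀ i k j p, radialProduct x S i k j p + (gaugeTensor d (specialTensor x W) β i k j p
        + gaugeTensor d (specialTensor x W) β j p i k)
      = radialProduct x S k i p j + (gaugeTensor d (specialTensor x W) β k i p j
        + gaugeTensor d (specialTensor x W) β p j k i) := by
    intro i k j p
    rw [hanti1 i k, hanti2 k i, hanti1 j p, hanti2 p j]
    simp only [radialProduct]; ring
  refine ⟨fun i k j p => radialProduct x S i k j p + (gaugeTensor d (specialTensor x W) β i k j p
    + gaugeTensor d (specialTensor x W) β j p i k), ?_, ?_, ?_, ?_, ?_, ?_⟩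
  · intro i k j p
    simp only
    rw [hanti1 i k, hanti2 j p i k]
    simp only [radialProduct]; ring
  · intro i k j p
    simp only
    rw [hanti2 i k, hanti1 j p i k]
    simp only [radialProduct]; ring
  · intro i k j p
    simp only [radialProduct]
    rw [hSsym p k, hSsym j i, hSsym p i, hSsym j k]; ring
  · intro i k j p
    have := hbianchi i k j p
    simp only [radialProduct]
    rw [hSsym j p, hSsym k p, hSsym j k]
    linear_combination this
  · intro k p
    rw [sum_congr rfl fun i _ => hsymm i k i p]
    simp only [sum_add_distrib, hR, htr, hb]
    have e : ∀ i, ∑ m, x m * S i m = 2 * (n - 3) * ∑ m, x m * Z i m := by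
      intro i; rw [mul_sum]; exact sum_congr rfl fun m _ => by rw [← hZS]; ring
    have hZsym : Z p k = Z k p := by rw [← hZ, ← hZ, hWsym]
    rw [e, e, ← hZS, hZsym]; ring
  · intro i j
    rw [← sum_sum_deriv_radialProduct hx hSsym hSdiv hUdiv hU hT i j]
    simp only [map_add, sum_add_distrib]
    have h1 : ∑ k, ∑ p, d k (d p (gaugeTensor d (specialTensor x W) β i k j p)) = 0 := by
      rw [sum_comm]
      refine sum_eq_zero fun p _ => ?_
      rw [sum_congr rfl fun k _ => hcomm _ _ _, ← map_sum, hdiv, map_zero]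
    have h2 : ∑ k, ∑ p, d k (d p (gaugeTensor d (specialTensor x W) β j p i k)) = 0 := by
      refine sum_eq_zero fun k _ => ?_
      rw [← map_sum, hdiv, map_zero]
    rw [h1, h2]; simp

theorem natCast_sub_two {A : Type*} [CommRing A] [Algebra ℝ A] (n : ℕ) :
    ((n + 4 : ℕ) : A) - 2 = algebraMap ℝ A (n + 2) := by
  simp only [map_add, map_natCast, map_ofNat]; push_cast; ring

theorem two_mul_natCast_sub_three {A : Type*} [CommRing A] [Algebra ℝ A] (n : ℕ) :
    2 * (((n + 4 : ℕ) : A) - 3) = algebraMap ℝ A (2 * (n + 1)) := by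
  simp only [map_add, map_mul, map_natCast, map_ofNat, map_one]; push_cast; ring

/-- In dimension at least four, given inverses `ray m` of the operators `E + m + 1` (`E` the Euler
operator), every symmetric transverse traceless tensor has a potential with Weyl symmetries. -/
theorem exists_weyl_potential_of_ray {A : Type*} [CommRing A] [Algebra ℝ A] {D : ℕ} (hD : 4 ≤ D)
    {d : Fin D → Derivation ℝ A A} {x : Fin D → A}
    (hcomm : ∀ i j f, d i (d j f) = d j (d i f)) (hx : ∀ j k, d j (x k) = kron A j k)
    {ray : ℕ → A →ₗ[ℝ] A} (hray : ∀ m k f, d k (ray m f) = ray (m + 1) (d k f))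
    (heuler : ∀ m f, euler d x (ray m f) + (m + 1) * ray m f = f)
    {t : Fin D → Fin D → A} (ht : ∀ i j, t i j = t j i)
    (htdiv : ∀ i, ∑ j, d j (t i j) = 0) (httr : ∑ i, t i i = 0) :
    ∃ C : Fin D → Fin D → Fin D → Fin D → A,
      (∀ i k j p, C i k j p = - C k i j p) ∧
      (∀ i k j p, C i k j p = - C i k p j) ∧
      (∀ i k j p, C i k j p = C j p i k) ∧
      (∀ i k j p, C i k j p + C i j p k + C i p k j = 0) ∧
      (∀ k p, ∑ i, C i k i p = 0) ∧
      (∀ i j, t i j = ∑ k, ∑ p, d k (d p (C i k j p))) := by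
  obtain ⟨n, rfl⟩ : ∃ n, D = n + 4 := ⟨D - 4, by omega⟩
  have hdiv : ∀ m {f : Fin (n + 4) → A}, ∑ j, d j (f j) = 0 → ∑ j, d j (ray m (f j)) = 0 := by
    intro m f hf
    simp only [hray, ← map_sum, hf, map_zero]
  let U : Fin (n + 4) → Fin (n + 4) → A := fun i j => ray (n + 2) (t i j)
  let S : Fin (n + 4) → Fin (n + 4) → A := fun i j => ray (n + 3) (U i j)
  let c : ℝ := (2 * (n + 1))⁻¹
  let W : Fin (n + 4) → Fin (n + 4) → A := fun i j => c • ray (n + 4) (S i j)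
  have hS : ∀ i j, S i j = S j i := fun i j => by simp only [S, U, ht i j]
  have hUdiv : ∀ i, ∑ j, d j (U i j) = 0 := fun i => hdiv _ (htdiv i)
  have hSdiv : ∀ i, ∑ j, d j (S i j) = 0 := fun i => hdiv _ (hUdiv i)
  have hStr : ∑ i, S i i = 0 := by simp only [S, U, ← map_sum, httr, map_zero]
  refine exists_weyl_potential (d := d)
    (x := x) hcomm hx (W := W)
    (Z := fun i j => c • S i j) (S := S) (U := U) (T := t)
    (β := fun i => ((n + 2 : ℝ)⁻¹) • ∑ k, specialTensor x W i k k)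
    ?_ ?_ ?_ ?_ ?_ ?_ hS hSdiv hStr ?_ ?_ ?_
  · intro i j
    simp only [W, hS i j]
  · intro i
    simp only [W, Derivation.map_smul, ← smul_sum, hdiv _ (hSdiv i), smul_zero]
  · simp only [W, ← smul_sum, ← map_sum, hStr, map_zero, smul_zero]
  · intro i
    rw [natCast_sub_two, ← Algebra.smul_def, smul_smul, mul_inv_cancel₀ (by positivity), one_smul]
  · intro i j
    have h := congrArg (c • ·) (heuler (n + 4) (S i j))
    simp only [euler, smul_add, smul_sum] at h
    simp only [euler, W, Derivation.map_smul, mul_smul_comm]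
    exact h
  · intro i j
    rw [two_mul_natCast_sub_three, ← Algebra.smul_def, smul_smul,
      mul_inv_cancel₀ (by positivity), one_smul]
  · intro j
    have : ∀ i, U i j = U j i := fun i => by simp only [U, ht i j]
    simpa only [this] using hUdiv j
  · intro i j
    have h := heuler (n + 3) (U i j)
    rw [← h]; push_cast; ring
  · intro i j
    have h := heuler (n + 2) (t i j)
    rw [← h]; push_cast; ring

end algebra

section integral
open MeasureTheory Topology Set
open scoped NNReal ENNReal
variable {E F : Type*} [NormedAddCommGroup E] [NormedSpace ℝ E]
  [NormedAddCommGroup F] [NormedSpace ℝ F]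

theorem HasFPowerSeriesOnBall.integral_comp_clm {f : E → ℝ}
    {p : FormalMultilinearSeries ℝ E ℝ} {y₀ : E} {r : ℝ≥0∞} (hf : HasFPowerSeriesOnBall f p y₀ r)
    {μ : Measure ℝ} [IsFiniteMeasure μ] {w : ℝ → ℝ} (hw : Continuous w) {L : ℝ → F →L[ℝ] E}
    (hL : Continuous L) {M ρ : ℝ≥0} (hb : ∀ᵐ t ∂μ, ‖w t‖ ≤ 1 ∧ ‖L t‖ ≤ M) (hρ : 0 < ρ)
    (hMρ : ((M * ρ : ℝ≥0) : ℝ≥0∞) < r) :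
    HasFPowerSeriesOnBall (fun z => ∫ t, w t * f (y₀ + L t z) ∂μ)
      (fun n => ∫ t, w t • (p n).compContinuousLinearMap (fun _ => L t) ∂μ) 0 ρ := by
  have hcont : ∀ n, Continuous fun t => w t • (p n).compContinuousLinearMap (fun _ => L t) := by
    intro n
    refine hw.smul ?_
    have h := (ContinuousMultilinearMap.compContinuousLinearMapContinuousMultilinear ℝ
      (fun _ : Fin n => F) (fun _ : Fin n => E) ℝ).cont
    exact ((ContinuousLinearMap.apply ℝ _ (p n)).continuous.comp h).comp
      (continuous_pi fun _ => hL)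
  have hbd : ∀ n, ∀ᵐ t ∂μ, ‖w t • (p n).compContinuousLinearMap (fun _ => L t)‖
      ≤ ‖p n‖ * M ^ n := by
    intro n
    filter_upwards [hb] with t ht
    rw [norm_smul]
    have h1 := (p n).norm_compContinuousLinearMap_le (fun _ => L t)
    have h2 : ∏ _i : Fin n, ‖L t‖ ≤ (M : ℝ) ^ n := by
      rw [Finset.prod_const, Finset.card_univ, Fintype.card_fin]
      exact pow_le_pow_left₀ (norm_nonneg _) ht.2 n
    calc ‖w t‖ * ‖(p n).compContinuousLinearMap (fun _ => L t)‖
        ≤ 1 * (‖p n‖ * M ^ n) := by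
          refine mul_le_mul ht.1 (h1.trans ?_) (norm_nonneg _) zero_le_one
          exact mul_le_mul_of_nonneg_left h2 (norm_nonneg _)
      _ = _ := one_mul _
  have hint : ∀ n, Integrable (fun t => w t • (p n).compContinuousLinearMap (fun _ => L t)) μ :=
    fun n => Integrable.of_bound (hcont n).aestronglyMeasurable _ (hbd n)
  have hrad : ((M * ρ : ℝ≥0) : ℝ≥0∞) < p.radius := hMρ.trans_le hf.r_le
  refine ⟨?_, by exact_mod_cast hρ, ?_⟩
  · obtain ⟨C, -, hC⟩ := p.norm_mul_pow_le_of_lt_radius hrad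
    refine FormalMultilinearSeries.le_radius_of_bound _ (C * μ.real univ) fun n => ?_
    have := norm_integral_le_of_norm_le_const (hbd n)
    calc _ ≤ (‖p n‖ * M ^ n * μ.real univ) * ρ ^ n := by gcongr
      _ = (‖p n‖ * ((M * ρ : ℝ≥0) : ℝ) ^ n) * μ.real univ := by push_cast; ring
      _ ≤ _ := by gcongr; exact hC n
  · intro y hy
    have hy' : ‖y‖ ≤ ρ := by
      have : ‖y‖ < ρ := by simpa using hy
      exact this.le
    simp only [zero_add]
    have hap : ∀ n, (∫ t, w t • (p n).compContinuousLinearMap (fun _ => L t) ∂μ)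
        (fun _ : Fin n => y) = ∫ t, w t * p n (fun _ => L t y) ∂μ := by
      intro n
      rw [ContinuousMultilinearMap.integral_apply (hint n)]
      rfl
    simp only [hap]
    refine hasSum_integral_of_dominated_convergence
      (fun n _ => ‖p n‖ * ((M * ρ : ℝ≥0) : ℝ) ^ n) (fun n => ?_) (fun n => ?_) ?_ ?_ ?_
    · refine Continuous.aestronglyMeasurable (hw.mul ((p n).cont.comp (continuous_pi fun _ => ?_)))
      exact hL.clm_apply continuous_const
    · filter_upwards [hbd n] with t ht
      have h := (w t • (p n).compContinuousLinearMap (fun _ => L t)).le_of_opNorm_le ht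
        (fun _ => y)
      refine h.trans ?_
      rw [Finset.prod_const, Finset.card_univ, Fintype.card_fin, NNReal.coe_mul, mul_pow,
        ← mul_assoc]
      gcongr
    · exact Filter.Eventually.of_forall fun _ => p.summable_norm_mul_pow hrad
    · exact integrable_const _
    · filter_upwards [hb] with t ht
      refine (hf.hasSum ?_).mul_left _
      have h1 : ‖L t y‖ ≤ M * ρ := (L t).le_of_opNorm_le_of_le ht.2 hy'
      have h2 : ‖L t y‖₊ ≤ M * ρ := by exact_mod_cast h1
      rw [Metric.mem_eball, edist_zero_right]
      exact lt_of_le_of_lt (by exact_mod_cast h2) hMρ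

/-- The weighted average `∫₀¹ tᵐ f(t x) dt` of `f` along the ray through `x`. -/
noncomputable def rayIntegral (m : ℕ) (f : E → ℝ) (x : E) : ℝ :=
  ∫ t in (0 : ℝ)..1, t ^ m * f (t • x)

theorem exists_nhds_analyticAt_setIntegral {f : E → ℝ} (hf : AnalyticOnNhd ℝ f univ) (m : ℕ)
    (x₀ : E) (t₀ : ℝ) :
    ∃ s ∈ 𝓝 t₀, MeasurableSet s ∧ ∀ u, MeasurableSet u → u ⊆ s ∩ Icc 0 1 →
      AnalyticAt ℝ (fun x => ∫ t in u, t ^ m * f (t • x)) x₀ := by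
  obtain ⟨p, r, hp⟩ := hf (t₀ • x₀) (mem_univ _)
  obtain ⟨ε, hε, hεr⟩ := ENNReal.lt_iff_exists_nnreal_btwn.1 hp.r_pos
  have hε0 : 0 < ε := by exact_mod_cast hε
  obtain ⟨δ, hδ0, hδ⟩ : ∃ δ : ℝ, 0 < δ ∧ δ * ‖x₀‖ < ε / 2 :=
    ⟨ε / 2 / (‖x₀‖ + 1), by positivity, by
      have : (0 : ℝ) < ε := hε0
      rw [div_mul_eq_mul_div, div_lt_iff₀ (by positivity)]
      nlinarith [norm_nonneg x₀]⟩
  refine ⟨Metric.closedBall t₀ δ, Metric.closedBall_mem_nhds _ hδ0,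
    Metric.isClosed_closedBall.measurableSet, fun u hu hus => ?_⟩
  set L : ℝ → E × E →L[ℝ] E := fun t => ((t - t₀) / δ) • ContinuousLinearMap.fst ℝ E E
    + t • ContinuousLinearMap.snd ℝ E E with hLdef
  have hL : Continuous L := by fun_prop
  have hfin : volume u < ⊤ := (measure_mono (hus.trans inter_subset_right)).trans_lt (by simp)
  have : IsFiniteMeasure (volume.restrict u) := ⟨by simpa using hfin⟩
  have hb : ∀ᵐ t ∂(volume.restrict u), ‖t ^ m‖ ≤ 1 ∧ ‖L t‖ ≤ (2 : ℝ≥0) := by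
    refine (ae_restrict_iff' hu).2 (Filter.Eventually.of_forall fun t ht => ?_)
    obtain ⟨h1, h2, h3⟩ := hus ht
    refine ⟨?_, ?_⟩
    · rw [Real.norm_of_nonneg (by positivity)]; exact pow_le_one₀ h2 h3
    · have e1 : ‖(t - t₀) / δ‖ ≤ 1 := by
        rw [norm_div, Real.norm_of_nonneg hδ0.le]
        exact div_le_one_of_le₀ (by simpa [Real.dist_eq] using h1) hδ0.le
      have e2 : ‖t‖ ≤ 1 := by rwa [Real.norm_of_nonneg h2]
      calc ‖L t‖ ≤ ‖(t - t₀) / δ‖ * ‖ContinuousLinearMap.fst ℝ E E‖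
            + ‖t‖ * ‖ContinuousLinearMap.snd ℝ E E‖ := by
            refine (norm_add_le _ _).trans ?_
            rw [norm_smul, norm_smul]
        _ ≤ 1 * 1 + 1 * 1 := by
            gcongr
            · exact ContinuousLinearMap.norm_fst_le ..
            · exact ContinuousLinearMap.norm_snd_le ..
        _ = _ := by norm_num
  have key := hp.integral_comp_clm (w := fun t => t ^ m) (by fun_prop) hL hb
    (ρ := ε / 2) (by positivity) (by rwa [mul_div_cancel₀ _ (two_ne_zero)])
  have hz : AnalyticAt ℝ (fun x : E => (δ • x₀, x - x₀)) x₀ := by fun_prop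
  have hmem : (δ • x₀, x₀ - x₀) ∈ Metric.eball (0 : E × E) (ε / 2 : ℝ≥0) := by
    rw [Metric.mem_eball, edist_zero_right, enorm_lt_coe, ← NNReal.coe_lt_coe]
    simp only [sub_self, coe_nnnorm, Prod.norm_mk, norm_zero, norm_smul,
      Real.norm_of_nonneg hδ0.le]
    have : (0 : ℝ) < ε := hε0
    push_cast
    exact max_lt hδ (by positivity)
  have := (key.analyticAt_of_mem hmem).comp_of_eq hz rfl
  refine this.congr (Filter.Eventually.of_forall fun x => ?_)
  simp only [Function.comp]
  congr 1
  ext t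
  congr 2
  simp only [hLdef, add_apply, smul_apply,
    ContinuousLinearMap.coe_fst', ContinuousLinearMap.coe_snd', smul_smul,
    div_mul_cancel₀ _ hδ0.ne', smul_sub, sub_smul]
  abel

theorem AnalyticOnNhd.rayIntegral {f : E → ℝ} (hf : AnalyticOnNhd ℝ f univ) (m : ℕ) :
    AnalyticOnNhd ℝ (rayIntegral m f) univ := by
  intro x₀ _
  have hfc : Continuous f := continuousOn_univ.1 hf.continuousOn
  have hint : ∀ x, ∀ u ⊆ Icc (0 : ℝ) 1, IntegrableOn (fun t => t ^ m * f (t • x)) u := by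
    intro x u hu
    have : Continuous fun t : ℝ => t ^ m * f (t • x) := by fun_prop
    exact (this.integrableOn_Icc).mono_set hu
  obtain ⟨s, hs, hsm, H⟩ : ∃ s, Icc (0 : ℝ) 1 ⊆ s ∧ MeasurableSet s ∧
      ∀ u, MeasurableSet u → u ⊆ s ∩ Icc 0 1 →
      AnalyticAt ℝ (fun x => ∫ t in u, t ^ m * f (t • x)) x₀ := by
    refine isCompact_Icc.induction_on (p := fun v => ∃ s, v ⊆ s ∧ MeasurableSet s ∧
      ∀ u, MeasurableSet u → u ⊆ s ∩ Icc 0 1 →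
      AnalyticAt ℝ (fun x => ∫ t in u, t ^ m * f (t • x)) x₀) ?_ ?_ ?_ ?_
    · refine ⟨∅, Subset.rfl, MeasurableSet.empty, fun u _ hu => ?_⟩
      have : u = ∅ := by simpa using hu
      subst this
      simpa using analyticAt_const
    · rintro v v' hv ⟨s, h1, h2⟩
      exact ⟨s, hv.trans h1, h2⟩
    · rintro v v' ⟨s, h1, h2, h3⟩ ⟨s', h1', h2', h3'⟩
      refine ⟨s ∪ s', union_subset_union h1 h1', h2.union h2', fun u hu hus => ?_⟩
      have hsub : u ⊆ Icc 0 1 := hus.trans inter_subset_right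
      have a1 := h3 (u ∩ s) (hu.inter h2) fun t ht => ⟨ht.2, hsub ht.1⟩
      have a2 := h3' (u \ s) (hu.diff h2) fun t ht =>
        ⟨(hus ht.1).1.resolve_left ht.2, hsub ht.1⟩
      refine (a1.add a2).congr (Filter.Eventually.of_forall fun x => ?_)
      exact integral_inter_add_sdiff h2 (hint x u hsub)
    · intro t₀ _
      obtain ⟨s, hs, hsm, H⟩ := exists_nhds_analyticAt_setIntegral hf m x₀ t₀
      exact ⟨s, mem_nhdsWithin_of_mem_nhds hs, s, Subset.rfl, hsm, H⟩
  refine (H (Ioc 0 1) measurableSet_Ioc fun t ht =>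
    ⟨hs (Ioc_subset_Icc_self ht), Ioc_subset_Icc_self ht⟩).congr
      (Filter.Eventually.of_forall fun x => ?_)
  simp only [_root_.rayIntegral, intervalIntegral.integral_of_le zero_le_one]

theorem hasFDerivAt_rayIntegral [FiniteDimensional ℝ E] {f : E → ℝ} (hf : ContDiff ℝ 1 f) (m : ℕ)
    (x : E) :
    HasFDerivAt (rayIntegral m f) (∫ t in (0 : ℝ)..1, (t ^ (m + 1)) • fderiv ℝ f (t • x)) x := by
  have hd := hf.continuous_fderiv one_ne_zero
  have hfc := hf.continuous
  have hF' : Continuous fun q : E × ℝ => (q.2 ^ (m + 1)) • fderiv ℝ f (q.2 • q.1) := by fun_prop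
  have : ProperSpace E := FiniteDimensional.proper ℝ E
  obtain ⟨C, hC⟩ := ((isCompact_closedBall x 1).prod
    (isCompact_Icc (a := (0 : ℝ)) (b := 1))).exists_bound_of_continuousOn hF'.continuousOn
  refine intervalIntegral.hasFDerivAt_integral_of_dominated_of_fderiv_le
    (F' := fun y t => (t ^ (m + 1)) • fderiv ℝ f (t • y)) (bound := fun _ => C)
    (Metric.closedBall_mem_nhds x one_pos) ?_ ?_ ?_ ?_ ?_ ?_
  · refine Filter.Eventually.of_forall fun y => Continuous.aestronglyMeasurable ?_
    fun_prop
  · apply Continuous.intervalIntegrable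
    fun_prop
  · refine Continuous.aestronglyMeasurable ?_
    fun_prop
  · refine Filter.Eventually.of_forall fun t ht y hy => hC (y, t) ⟨hy, ?_⟩
    rw [uIoc_of_le zero_le_one] at ht
    exact Ioc_subset_Icc_self ht
  · exact intervalIntegrable_const
  · refine Filter.Eventually.of_forall fun t _ y _ => ?_
    have h1 : HasFDerivAt (fun y : E => t • y) (t • ContinuousLinearMap.id ℝ E) y :=
      (hasFDerivAt_id y).const_smul t
    have h2 := ((hf.differentiable one_ne_zero (t • y)).hasFDerivAt.comp y h1).const_mul (t ^ m)
    refine h2.congr_fderiv ?_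
    ext v
    simp
    ring

end integral

section rayIntegral
variable {D : ℕ}

theorem pd_rayIntegral {f : (Fin D → ℝ) → ℝ} (hf : ContDiff ℝ 1 f) (m : ℕ) (k : Fin D) :
    pd k (rayIntegral m f) = rayIntegral (m + 1) (pd k f) := by
  ext x
  have hd := hf.continuous_fderiv one_ne_zero
  rw [pd, (hasFDerivAt_rayIntegral hf m x).fderiv, ContinuousLinearMap.intervalIntegral_apply]
  · rfl
  · apply Continuous.intervalIntegrable
    fun_prop

theorem euler_rayIntegral {f : (Fin D → ℝ) → ℝ} (hf : ContDiff ℝ 1 f) (m : ℕ) (x : Fin D → ℝ) :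
    ∑ k, x k * pd k (rayIntegral m f) x + (m + 1) * rayIntegral m f x = f x := by
  have hd := hf.continuous_fderiv one_ne_zero
  have hfc := hf.continuous
  have hfd : ∀ t : ℝ, HasDerivAt (fun t : ℝ => t ^ (m + 1) * f (t • x))
      (((m + 1 : ℕ) * t ^ m) * f (t • x) + t ^ (m + 1) * fderiv ℝ f (t • x) x) t := by
    intro t
    have h1 : HasDerivAt (fun t : ℝ => t • x) x t := by
      simpa using (hasDerivAt_id t).smul_const x
    have h2 := (hf.differentiable one_ne_zero (t • x)).hasFDerivAt.comp_hasDerivAt t h1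
    exact ((hasDerivAt_pow (m + 1) t).mul h2).congr_deriv (by simp)
  have h := intervalIntegral.integral_eq_sub_of_hasDerivAt (a := 0) (b := 1)
    (fun t _ => hfd t) (by apply Continuous.intervalIntegrable; fun_prop)
  rw [intervalIntegral.integral_add (by apply Continuous.intervalIntegrable; fun_prop)
    (by apply Continuous.intervalIntegrable; fun_prop)] at h
  have hx : ∑ k, x k * pd k (rayIntegral m f) x
      = ∫ t in (0 : ℝ)..1, t ^ (m + 1) * fderiv ℝ f (t • x) x := by
    simp only [pd_rayIntegral hf, rayIntegral, ← intervalIntegral.integral_const_mul]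
    rw [← intervalIntegral.integral_finsetSum fun k _ => by
      apply Continuous.intervalIntegrable; simp only [pd]; fun_prop]
    refine intervalIntegral.integral_congr fun t _ => ?_
    simp only [pd]
    conv_rhs => rw [← Finset.univ_sum_single x]
    simp only [map_sum, mul_sum]
    refine sum_congr rfl fun k _ => ?_
    have : (Pi.single k (x k) : Fin D → ℝ) = x k • Pi.single k 1 := by
      rw [← Pi.single_smul']; simp
    rw [Finset.univ_sum_single x, this, map_smul, smul_eq_mul]; ring
  rw [hx, rayIntegral, ← intervalIntegral.integral_const_mul]
  simp at h
  rw [← h, add_comm]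
  congr 2
  ext t
  ring

end rayIntegral

section analyticAlgebra
variable {D : ℕ}

theorem AnalyticOnNhd.pd {f : (Fin D → ℝ) → ℝ} (hf : AnalyticOnNhd ℝ f Set.univ) (k : Fin D) :
    AnalyticOnNhd ℝ (pd k f) Set.univ :=
  fun x hx => ((ContinuousLinearMap.apply ℝ ℝ (Pi.single k 1 : Fin D → ℝ)).analyticAt
    (fderiv ℝ f x)).comp (hf.fderiv x hx)

theorem AnalyticOnNhd.differentiableAt_of_univ {f : (Fin D → ℝ) → ℝ}
    (hf : AnalyticOnNhd ℝ f Set.univ) (x : Fin D → ℝ) : DifferentiableAt ℝ f x :=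
  (hf x (Set.mem_univ x)).differentiableAt

variable (D) in
/-- The algebra of real-analytic functions on `ℝ^D`. -/
def analyticSubalgebra : Subalgebra ℝ ((Fin D → ℝ) → ℝ) where
  carrier := {f | AnalyticOnNhd ℝ f Set.univ}
  mul_mem' hf hg := hf.mul hg
  add_mem' hf hg := hf.add hg
  algebraMap_mem' _ := analyticOnNhd_const

/-- The `k`-th partial derivative as a derivation of the algebra of real-analytic functions. -/
noncomputable def partialDerivation (k : Fin D) :
    Derivation ℝ (analyticSubalgebra D) (analyticSubalgebra D) :=
  Derivation.mk'
    { toFun := fun f => ⟨pd k f, AnalyticOnNhd.pd f.2 k⟩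
      map_add' := fun f g => Subtype.ext <| funext fun x => by
        simp [pd, fderiv_add (AnalyticOnNhd.differentiableAt_of_univ f.2 x)
          (AnalyticOnNhd.differentiableAt_of_univ g.2 x)]
      map_smul' := fun c f => Subtype.ext <| funext fun x => by
        simp [pd, fderiv_const_smul (AnalyticOnNhd.differentiableAt_of_univ f.2 x)] }
    fun f g => Subtype.ext <| funext fun x => by
      simp [pd, fderiv_mul (AnalyticOnNhd.differentiableAt_of_univ f.2 x)
        (AnalyticOnNhd.differentiableAt_of_univ g.2 x)]

@[simp] theorem coe_partialDerivation (k : Fin D) (f : analyticSubalgebra D) :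
    (partialDerivation k f : (Fin D → ℝ) → ℝ) = pd k f := rfl

theorem partialDerivation_comm (i j : Fin D) (f : analyticSubalgebra D) :
    partialDerivation i (partialDerivation j f) = partialDerivation j (partialDerivation i f) := by
  refine Subtype.ext <| funext fun x => ?_
  have hf := f.2 x (Set.mem_univ x)
  have hd : DifferentiableAt ℝ (fderiv ℝ (f : (Fin D → ℝ) → ℝ)) x := hf.fderiv.differentiableAt
  have h : ∀ i j : Fin D, pd i (pd j f) x
      = fderiv ℝ (fderiv ℝ (f : (Fin D → ℝ) → ℝ)) x (Pi.single i 1) (Pi.single j 1) := by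
    intro i j
    have := (hd.hasFDerivAt.clm_apply (hasFDerivAt_const (Pi.single j (1 : ℝ)) x)).fderiv
    change fderiv ℝ (fun x => fderiv ℝ (f : (Fin D → ℝ) → ℝ) x (Pi.single j 1)) x _ = _
    rw [this]; simp
  simp only [coe_partialDerivation, h]
  exact hf.contDiffAt.isSymmSndFDerivAt_of_omega _ _

/-- The `k`-th coordinate as an element of the algebra of real-analytic functions. -/
def coordFun (k : Fin D) : analyticSubalgebra D :=
  ⟨fun x => x k,
    (ContinuousLinearMap.proj (R := ℝ) (φ := fun _ : Fin D => ℝ) k).analyticOnNhd Set.univ⟩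

theorem partialDerivation_coordFun (j k : Fin D) :
    partialDerivation j (coordFun k) = kron (analyticSubalgebra D) j k := by
  refine Subtype.ext <| funext fun x => ?_
  have : fderiv ℝ (fun x : Fin D → ℝ => x k) x = ContinuousLinearMap.proj (R := ℝ) k :=
    (ContinuousLinearMap.proj (R := ℝ) (φ := fun _ : Fin D => ℝ) k).fderiv
  simp only [coe_partialDerivation, pd, coordFun, this, kron]
  by_cases h : j = k
  · subst h; simp
  · simp [h, Ne.symm h]

/-- `rayIntegral` on the algebra of real-analytic functions, as a linear map. -/
noncomputable def rayMap (m : ℕ) : analyticSubalgebra D →ₗ[ℝ] analyticSubalgebra D where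
  toFun f := ⟨rayIntegral m f, AnalyticOnNhd.rayIntegral f.2 m⟩
  map_add' f g := Subtype.ext <| funext fun x => by
    have hf : Continuous (f : (Fin D → ℝ) → ℝ) := continuousOn_univ.1 f.2.continuousOn
    have hg : Continuous (g : (Fin D → ℝ) → ℝ) := continuousOn_univ.1 g.2.continuousOn
    simp only [rayIntegral, Subalgebra.coe_add, Pi.add_apply, mul_add]
    exact intervalIntegral.integral_add (by apply Continuous.intervalIntegrable; fun_prop)
      (by apply Continuous.intervalIntegrable; fun_prop)
  map_smul' c f := Subtype.ext <| funext fun x => by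
    simp only [rayIntegral, Subalgebra.coe_smul, Pi.smul_apply, RingHom.id_apply, smul_eq_mul,
      ← intervalIntegral.integral_const_mul]
    congr 1; ext t; ring

theorem partialDerivation_rayMap (m : ℕ) (k : Fin D) (f : analyticSubalgebra D) :
    partialDerivation k (rayMap m f) = rayMap (m + 1) (partialDerivation k f) :=
  Subtype.ext <| pd_rayIntegral f.2.contDiff m k

theorem euler_rayMap (m : ℕ) (f : analyticSubalgebra D) :
    euler partialDerivation coordFun (rayMap m f) + (m + 1) * rayMap m f = f := by
  refine Subtype.ext <| funext fun x => ?_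
  have := euler_rayIntegral (f := f) f.2.contDiff m x
  simpa [euler, coordFun, rayMap] using this

end analyticAlgebra

/-- Proposition 7: every real-analytic symmetric transverse traceless
tensor field on ℝ^D (D ≥ 4) is of the form T^{ij} = ∂_k∂_p C^{ikjp} for a real-analytic
tensor field C with Riemann symmetries and vanishing trace. -/
theorem stmt_19 (D : ℕ) (hD : 4 ≤ D)
    (T : Fin D → Fin D → (Fin D → ℝ) → ℝ)
    (hanalytic : ∀ i j, AnalyticOnNhd ℝ (T i j) Set.univ)
    (hsym : ∀ i j x, T i j x = T j i x)
    (htrans : ∀ i x, ∑ j, pd j (T i j) x = 0)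
    (htrace : ∀ x, ∑ i, T i i x = 0) :
    ∃ C : Fin D → Fin D → Fin D → Fin D → (Fin D → ℝ) → ℝ,
      (∀ i k j p, AnalyticOnNhd ℝ (C i k j p) Set.univ) ∧
      (∀ i k j p x, C i k j p x = - C k i j p x) ∧
      (∀ i k j p x, C i k j p x = - C i k p j x) ∧
      (∀ i k j p x, C i k j p x = C j p i k x) ∧
      (∀ i k j p x,
        (1/6 : ℝ) * (C i k j p x - C i j k p x - C i k p j x
          - C i p j k x + C i j p k x + C i p k j x) = 0) ∧
      (∀ k p x, ∑ i, C i k i p x = 0) ∧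
      (∀ i j x, T i j x = ∑ k, ∑ p, pd k (pd p (C i k j p)) x) := by
  let t : Fin D → Fin D → analyticSubalgebra D := fun i j => ⟨T i j, hanalytic i j⟩
  have ht : ∀ i j, t i j = t j i := fun i j => Subtype.ext <| funext <| hsym i j
  have htdiv : ∀ i, ∑ j, partialDerivation j (t i j) = 0 := fun i =>
    Subtype.ext <| funext fun x => by simpa [t] using htrans i x
  have httr : ∑ i, t i i = 0 := Subtype.ext <| funext fun x => by simpa [t] using htrace x
  obtain ⟨C, h1, h2, h3, h4, h5, h6⟩ := exists_weyl_potential_of_ray hD partialDerivation_comm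
    partialDerivation_coordFun partialDerivation_rayMap euler_rayMap ht htdiv httr
  have val : ∀ {f g : analyticSubalgebra D}, f = g → ∀ x, f.1 x = g.1 x :=
    fun h x => congrFun (congrArg Subtype.val h) x
  refine ⟨fun i k j p => C i k j p, fun i k j p => (C i k j p).2, fun i k j p => val (h1 i k j p),
    fun i k j p => val (h2 i k j p), fun i k j p => val (h3 i k j p), fun i k j p x => ?_,
    fun k p x => ?_, fun i j x => ?_⟩
  · have e1 := val (h2 i k j p) x
    have e2 := val (h2 i j k p) x
    have e3 := val (h2 i p j k) x
    have e4 := val (h4 i k j p) x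
    simp at e1 e2 e3 e4
    linarith
  · simpa using val (h5 k p) x
  · simpa [t] using val (h6 i j) x
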